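/- Let r, p, n be positive integers with p dividing r and n ≥ 2, let ξ = e^{2πi/r}, let Λ ⊆ ℂⁿ be a ℤ-lattice invariant under the full group G(r,1,n), and let W = G(r,p,n) ⋉ Λ. Let g ∈ W and write λ_1,…,λ_n for the diagonal entries of the monomial matrix Lin(g). Suppose that for distinct indices j ≠ ℓ: λ_j ∉ {0,1}, λ_ℓ ∉ {0,1}, and there exist an integer m and λ' ∈ Λ' := { x_1(λ) : λ ∈ Λ ∩ ℂ(e_1 − e_2) } with x_j(Tran(g))/(1 − λ_j) = ξ^m · x_ℓ(Tran(g))/(1 − λ_ℓ) + λ' (i.e., the two quotients lie in the same orbit of the action of G(r,1,1) ⋉ Λ' on ℂ by z ↦ ξ^m z + λ'). Then every vector of ℂⁿ fixed by g lies on a reflecting hyperplane of W. -/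

import Mathlib

open Matrix Complex

noncomputable section

/-- `ℤ[ζ] = ℤ + ℤζ` as a subset of `ℂ`. -/
def Zlat (ζ : ℂ) : Set ℂ := {z | ∃ a b : ℤ, z = (a : ℂ) + (b : ℂ) * ζ}

/-- Membership in the complex reflection group `G(r,p,n)`: monomial matrices whose
nonzero entries are `r`-th roots of unity and whose product of nonzero entries,
raised to the power `r / p`, equals `1`. -/
def IsGrpn (r p n : ℕ) (M : Matrix (Fin n) (Fin n) ℂ) : Prop :=
  (∀ i, ∃! j, M i j ≠ 0) ∧ (∀ j, ∃! i, M i j ≠ 0) ∧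
  (∀ i j, M i j ≠ 0 → M i j ^ r = 1) ∧
  (∏ i, ∑ j, M i j) ^ (r / p) = 1

/-- The affine transformation `v ↦ M v + t` encoded by the pair `g = (M, t)`. -/
def applyAff {n : ℕ} (g : Matrix (Fin n) (Fin n) ℂ × (Fin n → ℂ)) (v : Fin n → ℂ) :
    Fin n → ℂ :=
  g.1.mulVec v + g.2

/-- An affine hyperplane in `ℂⁿ`: the solution set of a nonzero affine-linear equation. -/
def IsAffineHyperplane {n : ℕ} (H : Set (Fin n → ℂ)) : Prop :=
  ∃ a : Fin n → ℂ, a ≠ 0 ∧ ∃ c : ℂ, H = {v | ∑ i, a i * v i = c}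

/-- A reflecting hyperplane of `W`: an affine hyperplane fixed pointwise by some
non-identity element of `W`. -/
def IsReflectingHyperplane {n : ℕ}
    (W : Matrix (Fin n) (Fin n) ℂ × (Fin n → ℂ) → Prop) (H : Set (Fin n → ℂ)) : Prop :=
  IsAffineHyperplane H ∧
  ∃ g, W g ∧ (∃ v, applyAff g v ≠ v) ∧ ∀ v ∈ H, applyAff g v = v

/-- `W` has the Steinberg property: every point fixed by some non-identity element
of `W` lies on a reflecting hyperplane of `W`. -/
def SteinbergProperty {n : ℕ}
    (W : Matrix (Fin n) (Fin n) ℂ × (Fin n → ℂ) → Prop) : Prop :=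
  ∀ u : Fin n → ℂ,
    (∃ g, W g ∧ (∃ v, applyAff g v ≠ v) ∧ applyAff g u = u) →
    ∃ H, IsReflectingHyperplane W H ∧ u ∈ H

/-- `stdGen n 0 = e₁` and, for `j ≥ 1` (0-indexed), `stdGen n j = e_{j-1} - e_j`. -/
def stdGen (n : ℕ) (j : Fin n) : Fin n → ℂ := fun i =>
  if i = j then (if (j : ℕ) = 0 then 1 else -1)
  else if (i : ℕ) + 1 = (j : ℕ) then 1 else 0

/-- `genB n ξ 0 = ξ e₁ - e₂` and, for `j ≥ 1` (0-indexed), `genB n ξ j = e_{j-1} - e_j`. -/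
def genB (n : ℕ) (ξ : ℂ) (j : Fin n) : Fin n → ℂ :=
  if (j : ℕ) = 0 then
    (fun i => if (i : ℕ) = 0 then ξ else if (i : ℕ) = 1 then -1 else 0)
  else stdGen n j

/-- The monomial matrix with entry `d i` in position `(i, σ i)`. -/
def monomialMatrix {n : ℕ} (σ : Equiv.Perm (Fin n)) (d : Fin n → ℂ) :
    Matrix (Fin n) (Fin n) ℂ :=
  fun i k => if k = σ i then d i else 0

lemma monomialMatrix_mulVec {n : ℕ} (σ : Equiv.Perm (Fin n)) (d v : Fin n → ℂ) (i : Fin n) :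
    (monomialMatrix σ d).mulVec v i = d i * v (σ i) := by
  simp [monomialMatrix, Matrix.mulVec, dotProduct]

lemma isGrpn_monomialMatrix {r p n : ℕ} (hr : 0 < r) (σ : Equiv.Perm (Fin n)) (d : Fin n → ℂ)
    (hd : ∀ i, d i ^ r = 1) (hprod : (∏ i, d i) ^ (r / p) = 1) :
    IsGrpn r p n (monomialMatrix σ d) := by
  have hd0 : ∀ i, d i ≠ 0 := fun i h => by
    have := hd i
    rw [h, zero_pow hr.ne'] at this
    exact zero_ne_one this
  refine ⟨fun i => ⟨σ i, ?_, ?_⟩, fun k => ⟨σ.symm k, ?_, ?_⟩, fun i k h => ?_, ?_⟩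
  · simp [monomialMatrix, hd0]
  · intro k hk
    by_contra h
    exact hk (if_neg h)
  · simp [monomialMatrix, hd0]
  · intro i hi
    by_contra h
    refine hi (if_neg fun hk => h ?_)
    rw [hk, Equiv.symm_apply_apply]
  · by_cases hk : k = σ i
    · simp [monomialMatrix, hk, hd]
    · exact absurd (if_neg hk) h
  · simpa [monomialMatrix] using hprod

lemma exists_perm_apply_eq_pair {α : Type*} [DecidableEq α] {j l a b : α} (hjl : j ≠ l)
    (hab : a ≠ b) : ∃ σ : Equiv.Perm α, σ j = a ∧ σ l = b := by
  refine ⟨(Equiv.swap j a).trans (Equiv.swap (Equiv.swap j a l) b), ?_, ?_⟩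
  · have h : a ≠ Equiv.swap j a l := fun h => hjl <| (Equiv.swap j a).injective <| by
      rw [Equiv.swap_apply_left, ← h]
    simp [Equiv.swap_apply_of_ne_of_ne h hab]
  · simp

/-- A coordinate of a fixed vector in a direction where the monomial matrix is diagonal. -/
lemma eq_div_of_applyAff_eq {r p n : ℕ} {g : Matrix (Fin n) (Fin n) ℂ × (Fin n → ℂ)}
    (hg : IsGrpn r p n g.1) {i : Fin n} (h0 : g.1 i i ≠ 0) (h1 : g.1 i i ≠ 1) {u : Fin n → ℂ}
    (hu : applyAff g u = u) : u i = g.2 i / (1 - g.1 i i) := by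
  have hsum : g.1.mulVec u i = g.1 i i * u i := by
    refine Finset.sum_eq_single i (fun k _ hk => ?_) (fun h => absurd (Finset.mem_univ i) h)
    have : g.1 i k = 0 := by
      by_contra h
      exact hk ((hg.1 i).unique h h0)
    simp [this]
  have hi : g.1.mulVec u i + g.2 i = u i := congrFun hu i
  rw [hsum] at hi
  rw [eq_div_iff (sub_ne_zero.mpr h1.symm)]
  linear_combination -hi

/-- The hyperplane `x_j = ζ x_l + t` is reflecting as soon as `ζ` is an `r`-th root of unity and
`t e_j - ζ⁻¹ t e_l` is an allowed translation. -/
lemma isReflectingHyperplane_of_translation_mem {r p n : ℕ} (hr : 0 < r) {Λ : Set (Fin n → ℂ)}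
    {j l : Fin n} (hjl : j ≠ l) {ζ t : ℂ} (hζ : ζ ^ r = 1)
    (hw : (Pi.single j t - Pi.single l (ζ⁻¹ * t) : Fin n → ℂ) ∈ Λ) :
    IsReflectingHyperplane (fun h => IsGrpn r p n h.1 ∧ h.2 ∈ Λ)
      {v | v j = ζ * v l + t} := by
  have hζ0 : ζ ≠ 0 := by
    rintro rfl
    simp [hr.ne'] at hζ
  set d : Fin n → ℂ := fun i => if i = j then ζ else if i = l then ζ⁻¹ else 1 with hd
  set w : Fin n → ℂ := Pi.single j t - Pi.single l (ζ⁻¹ * t) with hwdef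
  have hdj : d j = ζ := by simp [hd]
  have hdl : d l = ζ⁻¹ := by simp [hd, hjl.symm]
  have hwj : w j = t := by simp [hwdef, hjl]
  have hwl : w l = -(ζ⁻¹ * t) := by simp [hwdef, hjl.symm]
  have hprod : ∏ i, d i = 1 := by
    rw [Finset.prod_eq_mul j l hjl (fun i _ hi => by simp [hd, hi.1, hi.2]) (by simp) (by simp),
      hdj, hdl, mul_inv_cancel₀ hζ0]
  have happ : ∀ v i, applyAff (monomialMatrix (Equiv.swap j l) d, w) v i =
      d i * v (Equiv.swap j l i) + w i := fun v i => by
    rw [applyAff, Pi.add_apply, monomialMatrix_mulVec]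
  refine ⟨⟨Pi.single j 1 - Pi.single l ζ, fun h => ?_, t, ?_⟩,
    (monomialMatrix (Equiv.swap j l) d, w), ⟨isGrpn_monomialMatrix hr _ _ (fun i => ?_) ?_, hw⟩,
    ?_, ?_⟩
  · simpa [hjl] using congrFun h j
  · ext v
    simp only [Set.mem_ofPred_eq, Pi.sub_apply, sub_mul, Finset.sum_sub_distrib, Pi.single_apply,
      ite_mul, one_mul, zero_mul, Finset.sum_ite_eq', Finset.mem_univ, if_true]
    rw [sub_eq_iff_eq_add']
  · by_cases hij : i = j <;> by_cases hil : i = l <;> simp [hij, hil, hζ, hjl.symm]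
  · rw [hprod, one_pow]
  · by_contra! h
    have h₀ := congrFun (h 0) j
    have h₁ := congrFun (h (Pi.single j 1)) j
    rw [happ] at h₀ h₁
    simp only [hdj, hwj, Pi.zero_apply, mul_zero, zero_add] at h₀
    simp [hwj, hjl.symm, h₀] at h₁
  · intro v hv
    replace hv : v j = ζ * v l + t := hv
    ext i
    rw [happ]
    by_cases hij : i = j
    · subst hij
      rw [hdj, hwj, Equiv.swap_apply_left, hv]
    by_cases hil : i = l
    · subst hil
      rw [hdl, hwl, Equiv.swap_apply_right, hv]
      field_simp
      ring
    · simp [hd, hwdef, hij, hil, Equiv.swap_apply_of_ne_of_ne hij hil]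

/-- Lemma 5.1(3): if `λ_j, λ_ℓ ∉ {0,1}` and the quotients `x_j(Tran g)/(1-λ_j)` and
`x_ℓ(Tran g)/(1-λ_ℓ)` lie in the same orbit of `G(r,1,1) ⋉ Λ'` acting on `ℂ`, where
`Λ' = x₁(Λ ∩ ℂ(e₁ - e₂))`, then every vector fixed by `g ∈ W = G(r,p,n) ⋉ Λ` lies on
a reflecting hyperplane of `W`. -/
theorem fixed_lies_on_reflecting_hyperplane_case3
    (r p n : ℕ) (hr : 0 < r) (hp : 0 < p) (hpr : p ∣ r) (hn : 2 ≤ n)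
    (ξ : ℂ) (hξ : ξ = Complex.exp (2 * Real.pi * Complex.I / (r : ℂ)))
    (Λ : Set (Fin n → ℂ))
    (hlat : ∃ (k : ℕ) (b : Fin k → (Fin n → ℂ)), LinearIndependent ℝ b ∧
      Λ = {v | ∃ c : Fin k → ℤ, v = ∑ i, (c i : ℂ) • b i})
    (hinv : ∀ M, IsGrpn r 1 n M → ∀ v ∈ Λ, M.mulVec v ∈ Λ)
    (g : Matrix (Fin n) (Fin n) ℂ × (Fin n → ℂ))
    (hgW : IsGrpn r p n g.1 ∧ g.2 ∈ Λ)
    (j ℓ : Fin n) (hjl : j ≠ ℓ)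
    (hj0 : g.1 j j ≠ 0) (hj1 : g.1 j j ≠ 1)
    (hl0 : g.1 ℓ ℓ ≠ 0) (hl1 : g.1 ℓ ℓ ≠ 1)
    (horb : ∃ (m : ℤ) (lam' : ℂ),
      (∃ v ∈ Λ, (∃ t : ℂ, v = t • ((Pi.single (⟨0, by omega⟩ : Fin n) (1 : ℂ) : Fin n → ℂ) -
          (Pi.single (⟨1, by omega⟩ : Fin n) (1 : ℂ) : Fin n → ℂ))) ∧
        lam' = v ⟨0, by omega⟩) ∧
      g.2 j / (1 - g.1 j j) = ξ ^ m * (g.2 ℓ / (1 - g.1 ℓ ℓ)) + lam') :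
    ∀ u : Fin n → ℂ, applyAff g u = u →
      ∃ H, IsReflectingHyperplane (fun h => IsGrpn r p n h.1 ∧ h.2 ∈ Λ) H ∧ u ∈ H := by
  obtain ⟨m, lam', ⟨v, hv, ⟨t, hvt⟩, hlam⟩, horb⟩ := horb
  intro u hu
  set a : Fin n := ⟨0, by omega⟩
  set b : Fin n := ⟨1, by omega⟩
  have hab : a ≠ b := by simp [a, b]
  have hlam_t : lam' = t := by simp [hlam, hvt, hab]
  have hξr : ξ ^ r = 1 := hξ ▸ (Complex.isPrimitiveRoot_exp r hr.ne').pow_eq_one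
  have hζ : (ξ ^ m) ^ r = 1 := by
    rw [← zpow_natCast, ← _root_.zpow_mul, mul_comm, _root_.zpow_mul, zpow_natCast, hξr, _root_.one_zpow]
  refine ⟨{v | v j = ξ ^ m * v ℓ + t},
    isReflectingHyperplane_of_translation_mem hr hjl hζ ?_, ?_⟩
  · obtain ⟨σ, hσj, hσl⟩ := exists_perm_apply_eq_pair hjl hab
    set d : Fin n → ℂ := fun i => if i = ℓ then (ξ ^ m)⁻¹ else 1 with hd
    have hdr : ∀ i, d i ^ r = 1 := fun i => by
      simp only [hd]
      split_ifs <;> simp [hζ]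
    have hmem := hinv (monomialMatrix σ d)
      (isGrpn_monomialMatrix hr σ d hdr (by simp [← Finset.prod_pow, hdr])) v hv
    convert hmem using 1
    ext i
    rw [monomialMatrix_mulVec, hvt]
    have hia : σ i = a ↔ i = j := by rw [← hσj, σ.apply_eq_iff_eq]
    have hib : σ i = b ↔ i = ℓ := by rw [← hσl, σ.apply_eq_iff_eq]
    simp only [hd, Pi.sub_apply, Pi.smul_apply, Pi.single_apply, hia, hib, smul_eq_mul]
    by_cases hij : i = j
    · simp [hij, hjl]
    · by_cases hil : i = ℓ <;> simp [hij, hil, hjl.symm]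
  · change u j = ξ ^ m * u ℓ + t
    rw [eq_div_of_applyAff_eq hgW.1 hj0 hj1 hu, eq_div_of_applyAff_eq hgW.1 hl0 hl1 hu, horb, hlam_t]
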